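/- arXiv:2004.06462 — 2 statements merged into one kernel-verified Lean document; each statement's English description precedes it below -/
import Mathlib

section
/- Eigenrelation for the dual transform: for every real α > -1, every y ≥ 0, every n ∈ ℕ, and every quaternion q with ‖q‖ < 1, ∫_0^∞ R_q^α(x,y) φ_n^α(x) x^α e^{-x} dx = qⁿ · φ_n^α(y); that is, S_y^α maps the normalized Laguerre function φ_n^α to the monomial qⁿ multiplied by the scalar φ_n^α(y). -/
open MeasureTheory Real Quaternion

/-- Generalized Laguerre polynomial `L_n^{(α)}(x)`. -/
noncomputable def genLaguerre (α : ℝ) (n : ℕ) (x : ℝ) : ℝ :=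
  ∑ k ∈ Finset.range (n + 1),
    ((-1 : ℝ) ^ k / (Nat.factorial k)) *
      (Real.Gamma (n + α + 1) / (Real.Gamma (k + α + 1) * (Nat.factorial (n - k)))) * x ^ k

/-- Normalized Laguerre function `φ_n^α(x)`. -/
noncomputable def lagPhi (α : ℝ) (n : ℕ) (x : ℝ) : ℝ :=
  Real.sqrt ((Nat.factorial n : ℝ) / Real.Gamma (n + α + 1)) * genLaguerre α n x

/-- The kernel `R_q^α(x,y) = Σ_n qⁿ φ_n^α(x) φ_n^α(y)`. -/
noncomputable def Rker (α : ℝ) (q : ℍ[ℝ]) (x y : ℝ) : ℍ[ℝ] :=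
  ∑' n : ℕ, (lagPhi α n x * lagPhi α n y) • q ^ n

open Filter Topology Finset in
/-- Moments of the Laguerre weight. -/
lemma lag_moment (α : ℝ) (hα : -1 < α) (k : ℕ) :
    IntegrableOn (fun x : ℝ => x ^ k * (x ^ α * Real.exp (-x))) (Set.Ioi 0) ∧
    ∫ x in Set.Ioi (0 : ℝ), x ^ k * (x ^ α * Real.exp (-x)) = Real.Gamma (k + α + 1) := by
  have hpos : 0 < (k : ℝ) + α + 1 := by
    have : (0 : ℝ) ≤ k := Nat.cast_nonneg k
    linarith
  have hE : ∀ x ∈ Set.Ioi (0 : ℝ),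
      Real.exp (-x) * x ^ ((k : ℝ) + α + 1 - 1) = x ^ k * (x ^ α * Real.exp (-x)) := by
    intro x hx
    have hx' : (0 : ℝ) < x := hx
    rw [add_sub_cancel_right, Real.rpow_add hx', Real.rpow_natCast]
    ring
  constructor
  · exact (Real.GammaIntegral_convergent hpos).congr_fun hE measurableSet_Ioi
  · rw [Real.Gamma_eq_integral hpos]
    exact (setIntegral_congr_fun measurableSet_Ioi hE).symm

lemma lag_gamma_pos (α : ℝ) (hα : -1 < α) (k : ℕ) : 0 < Real.Gamma (k + α + 1) := by
  apply Real.Gamma_pos_of_pos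
  have : (0 : ℝ) ≤ k := Nat.cast_nonneg k
  linarith

lemma lag_gamma_succ (α : ℝ) (hα : -1 < α) (k : ℕ) :
    Real.Gamma ((k + 1 : ℕ) + α + 1) = (k + α + 1) * Real.Gamma (k + α + 1) := by
  rw [← Real.Gamma_add_one]
  · push_cast; ring_nf
  · have : (0 : ℝ) ≤ k := Nat.cast_nonneg k
    linarith

lemma lag_gamma_poch (α : ℝ) (hα : -1 < α) (k j : ℕ) :
    Real.Gamma ((k + j : ℕ) + α + 1) =
      (ascPochhammer ℝ j).eval (k + α + 1) * Real.Gamma (k + α + 1) := by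
  induction j with
  | zero => simp
  | succ j ih =>
    rw [← add_assoc, lag_gamma_succ α hα, ih, ascPochhammer_succ_right]
    simp
    ring

open Finset in
lemma lag_diff (α : ℝ) (m j : ℕ) (hj : j ≤ m) :
    ∑ k ∈ range (m + 1), (-1 : ℝ) ^ k * (m.choose k) * (ascPochhammer ℝ j).eval (k + α + 1) =
      if j = m then (-1 : ℝ) ^ m * m.factorial else 0 := by
  set P : Polynomial ℝ := (ascPochhammer ℝ j).comp (Polynomial.X + Polynomial.C (α + 1)) with hP
  have hdeg : P.natDegree = j := by
    simp only [hP, Polynomial.natDegree_comp, ascPochhammer_natDegree, mul_one,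
      Polynomial.natDegree_X_add_C]
  have hmon : P.Monic := Polynomial.Monic.comp_X_add_C (monic_ascPochhammer ℝ j) _
  have h1 : (fwdDiff (1 : ℝ))^[m] P.eval 0 = if j = m then (m.factorial : ℝ) else 0 := by
    split_ifs with h
    · have := congrFun P.fwdDiff_iter_degree_eq_factorial 0
      rw [hdeg, h, hmon.leadingCoeff] at this
      simpa using this
    · rw [Polynomial.fwdDiff_iter_eq_zero_of_degree_lt (by omega)]
      rfl
  rw [fwdDiff_iter_eq_sum_shift] at h1
  have h2 : ∑ k ∈ range (m + 1),
      (-1 : ℝ) ^ k * (m.choose k) * (ascPochhammer ℝ j).eval (k + α + 1) =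
      (-1) ^ m * ∑ k ∈ range (m + 1), ((-1 : ℤ) ^ (m - k) * (m.choose k)) •
        P.eval (0 + k • (1 : ℝ)) := by
    rw [mul_sum]
    refine sum_congr rfl fun k hk => ?_
    have hk' : k ≤ m := by simpa [Nat.lt_succ_iff] using hk
    have hs : (-1 : ℝ) ^ m * (-1) ^ (m - k) = (-1) ^ k := by
      obtain ⟨d, rfl⟩ := Nat.exists_eq_add_of_le hk'
      rw [Nat.add_sub_cancel_left, pow_add, mul_assoc, ← pow_add, ← two_mul, pow_mul]
      simp
    rw [← hs]
    simp [hP, zsmul_eq_mul, add_assoc]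
    ring
  rw [h2, h1]
  split_ifs <;> simp

lemma lag_cont (α : ℝ) (n : ℕ) : Continuous (genLaguerre α n) := by
  unfold genLaguerre
  fun_prop

open Finset in
/-- `∫ L_m x^j w`. -/
lemma lag_integral_pow (α : ℝ) (hα : -1 < α) (m j : ℕ) :
    IntegrableOn (fun x : ℝ => genLaguerre α m x * x ^ j * (x ^ α * Real.exp (-x))) (Set.Ioi 0) ∧
    (j ≤ m → ∫ x in Set.Ioi (0 : ℝ), genLaguerre α m x * x ^ j * (x ^ α * Real.exp (-x)) =
      if j = m then (-1 : ℝ) ^ m * Real.Gamma (m + α + 1) else 0) := by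
  have hE : (fun x : ℝ => genLaguerre α m x * x ^ j * (x ^ α * Real.exp (-x))) =
      fun x => ∑ k ∈ range (m + 1), (((-1 : ℝ) ^ k / (Nat.factorial k)) *
      (Real.Gamma (m + α + 1) / (Real.Gamma (k + α + 1) * (Nat.factorial (m - k))))) *
        (x ^ (k + j) * (x ^ α * Real.exp (-x))) := by
    funext x
    unfold genLaguerre
    rw [sum_mul, sum_mul]
    refine sum_congr rfl fun k _ => ?_
    rw [pow_add]; ring
  have hI : ∀ k ∈ range (m + 1), Integrable (fun x : ℝ => (((-1 : ℝ) ^ k / (Nat.factorial k)) *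
      (Real.Gamma (m + α + 1) / (Real.Gamma (k + α + 1) * (Nat.factorial (m - k))))) *
        (x ^ (k + j) * (x ^ α * Real.exp (-x)))) (volume.restrict (Set.Ioi 0)) :=
    fun k _ => (lag_moment α hα (k + j)).1.const_mul _
  rw [hE]
  refine ⟨integrable_finsetSum _ hI, fun hj => ?_⟩
  rw [integral_finsetSum _ hI]
  have h1 : ∀ k ∈ range (m + 1), ∫ x in Set.Ioi (0 : ℝ), (((-1 : ℝ) ^ k / (Nat.factorial k)) *
      (Real.Gamma (m + α + 1) / (Real.Gamma (k + α + 1) * (Nat.factorial (m - k))))) *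
        (x ^ (k + j) * (x ^ α * Real.exp (-x))) =
      Real.Gamma (m + α + 1) / m.factorial *
        ((-1 : ℝ) ^ k * (m.choose k) * (ascPochhammer ℝ j).eval (k + α + 1)) := by
    intro k hk
    have hk' : k ≤ m := by simpa [Nat.lt_succ_iff] using hk
    rw [integral_const_mul, (lag_moment α hα (k + j)).2, lag_gamma_poch α hα,
      Nat.cast_choose ℝ hk']
    have := (lag_gamma_pos α hα k).ne'
    have h2 : (m.factorial : ℝ) ≠ 0 := by positivity
    have h3 : (k.factorial : ℝ) ≠ 0 := by positivity
    have h4 : ((m - k).factorial : ℝ) ≠ 0 := by positivity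
    field_simp
  rw [sum_congr rfl h1, ← mul_sum, lag_diff α m j hj]
  have h2 : (m.factorial : ℝ) ≠ 0 := by positivity
  split_ifs
  · field_simp
  · simp

open Finset in
lemma lag_ortho_aux (α : ℝ) (hα : -1 < α) (m n : ℕ) :
    IntegrableOn (fun x : ℝ => genLaguerre α m x * genLaguerre α n x * (x ^ α * Real.exp (-x)))
      (Set.Ioi 0) ∧
    (n ≤ m → ∫ x in Set.Ioi (0 : ℝ),
      genLaguerre α m x * genLaguerre α n x * (x ^ α * Real.exp (-x)) =
      if n = m then Real.Gamma (m + α + 1) / m.factorial else 0) := by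
  have hE : (fun x : ℝ => genLaguerre α m x * genLaguerre α n x * (x ^ α * Real.exp (-x))) =
      fun x => ∑ k ∈ range (n + 1), (((-1 : ℝ) ^ k / (Nat.factorial k)) *
      (Real.Gamma (n + α + 1) / (Real.Gamma (k + α + 1) * (Nat.factorial (n - k))))) *
        (genLaguerre α m x * x ^ k * (x ^ α * Real.exp (-x))) := by
    funext x
    rw [genLaguerre.eq_1 α n x, mul_sum, sum_mul]
    refine sum_congr rfl fun k _ => ?_
    ring
  have hI : ∀ k ∈ range (n + 1), Integrable (fun x : ℝ => (((-1 : ℝ) ^ k / (Nat.factorial k)) *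
      (Real.Gamma (n + α + 1) / (Real.Gamma (k + α + 1) * (Nat.factorial (n - k))))) *
        (genLaguerre α m x * x ^ k * (x ^ α * Real.exp (-x)))) (volume.restrict (Set.Ioi 0)) :=
    fun k _ => (lag_integral_pow α hα m k).1.const_mul _
  rw [hE]
  refine ⟨integrable_finsetSum _ hI, fun hj => ?_⟩
  rw [integral_finsetSum _ hI, sum_range_succ, sum_eq_zero, zero_add]
  · rw [integral_const_mul, (lag_integral_pow α hα m n).2 hj]
    split_ifs with h
    · subst h
      have := (lag_gamma_pos α hα n).ne'
      have h2 : (n.factorial : ℝ) ≠ 0 := by positivity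
      have h3 : (-1 : ℝ) ^ n * (-1) ^ n = 1 := by rw [← mul_pow]; simp
      simp only [Nat.sub_self, Nat.factorial_zero, Nat.cast_one, mul_one]
      rw [div_self this]
      field_simp
      linear_combination h3
    · simp
  · intro k hk
    have hk' : k < n := by simpa using hk
    rw [integral_const_mul, (lag_integral_pow α hα m k).2 (by omega), if_neg (by omega), mul_zero]

lemma lag_phi_int (α : ℝ) (hα : -1 < α) (m n : ℕ) :
    IntegrableOn (fun x : ℝ => lagPhi α m x * lagPhi α n x * (x ^ α * Real.exp (-x)))
      (Set.Ioi 0) := by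
  have := (lag_ortho_aux α hα m n).1.const_mul
    (Real.sqrt ((Nat.factorial m : ℝ) / Real.Gamma (m + α + 1)) *
      Real.sqrt ((Nat.factorial n : ℝ) / Real.Gamma (n + α + 1)))
  refine this.congr (Filter.Eventually.of_forall fun x => ?_)
  simp only [lagPhi]
  ring

lemma lag_ortho_le (α : ℝ) (hα : -1 < α) (m n : ℕ) (h : n ≤ m) :
    ∫ x in Set.Ioi (0 : ℝ), lagPhi α m x * lagPhi α n x * (x ^ α * Real.exp (-x)) =
      if n = m then 1 else 0 := by
  have hE : (fun x : ℝ => lagPhi α m x * lagPhi α n x * (x ^ α * Real.exp (-x))) = fun x =>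
    (Real.sqrt ((Nat.factorial m : ℝ) / Real.Gamma (m + α + 1)) *
      Real.sqrt ((Nat.factorial n : ℝ) / Real.Gamma (n + α + 1))) *
      (genLaguerre α m x * genLaguerre α n x * (x ^ α * Real.exp (-x))) := by
    funext x
    simp only [lagPhi]
    ring
  rw [hE, integral_const_mul, (lag_ortho_aux α hα m n).2 h]
  split_ifs with h
  · subst h
    have := lag_gamma_pos α hα n
    have h2 : (0 : ℝ) < n.factorial := by positivity
    rw [Real.mul_self_sqrt (by positivity)]
    field_simp
  · simp

lemma lag_ortho (α : ℝ) (hα : -1 < α) (m n : ℕ) :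
    ∫ x in Set.Ioi (0 : ℝ), lagPhi α m x * lagPhi α n x * (x ^ α * Real.exp (-x)) =
      if n = m then 1 else 0 := by
  rcases le_total n m with h | h
  · exact lag_ortho_le α hα m n h
  · have := lag_ortho_le α hα n m h
    simp only [mul_comm (lagPhi α n _)] at this
    rw [this]
    simp [eq_comm]

open Filter Topology in
lemma lag_gamma_bound (α : ℝ) (hα : -1 < α) (z : ℝ) (hz : 0 < z) :
    ∃ C, 0 ≤ C ∧ ∀ k : ℕ, z ^ k / Real.Gamma (k + α + 1) ≤ C := by
  have hs : Summable (fun k : ℕ => z ^ k / Real.Gamma (k + α + 1)) := by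
    apply summable_of_ratio_test_tendsto_lt_one (l := 0) one_pos
    · refine Eventually.of_forall fun k => ?_
      have := lag_gamma_pos α hα k
      positivity
    · have h1 : Tendsto (fun k : ℕ => z / ((k : ℝ) + (α + 1))) atTop (𝓝 0) :=
        Tendsto.const_div_atTop (tendsto_atTop_add_const_right _ _ tendsto_natCast_atTop_atTop) _
      refine h1.congr fun k => ?_
      have hg := lag_gamma_pos α hα k
      have hg' := lag_gamma_pos α hα (k + 1)
      rw [Real.norm_of_nonneg (by positivity), Real.norm_of_nonneg (by positivity),
        lag_gamma_succ α hα, pow_succ]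
      have : (k : ℝ) + α + 1 ≠ 0 := by
        have : (0 : ℝ) ≤ k := Nat.cast_nonneg k
        linarith
      rw [← add_assoc]
      field_simp
  refine ⟨∑' k : ℕ, z ^ k / Real.Gamma (k + α + 1), ?_, fun k => ?_⟩
  · exact tsum_nonneg fun k => by have := lag_gamma_pos α hα k; positivity
  · exact hs.le_tsum k fun k _ => by have := lag_gamma_pos α hα k; positivity

open Filter Topology in
lemma lag_norm_summable (α : ℝ) (hα : -1 < α) (ρ : ℝ) (h0 : 0 < ρ) (h1 : ρ < 1) :
    Summable (fun m : ℕ => ρ ^ m * Real.sqrt (Real.Gamma (m + α + 1) / m.factorial)) := by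
  apply summable_of_ratio_test_tendsto_lt_one (l := ρ) h1
  · refine Eventually.of_forall fun k => ?_
    have := lag_gamma_pos α hα k
    positivity
  · have h2 : Tendsto (fun k : ℕ => 1 + α / ((k : ℝ) + 1)) atTop (𝓝 (1 + 0)) :=
      (Tendsto.const_div_atTop (tendsto_atTop_add_const_right _ _ tendsto_natCast_atTop_atTop)
        _).const_add _
    have h3 := (h2.sqrt).const_mul ρ
    simp only [add_zero, Real.sqrt_one, mul_one] at h3
    refine h3.congr fun k => ?_
    have hg := lag_gamma_pos α hα k
    have hg' := lag_gamma_pos α hα (k + 1)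
    rw [Real.norm_of_nonneg (by positivity), Real.norm_of_nonneg (by positivity), pow_succ]
    have hk : (0 : ℝ) ≤ k := Nat.cast_nonneg k
    have h5 : 0 ≤ 1 + α / ((k : ℝ) + 1) := by
      have : 1 + α / ((k : ℝ) + 1) = (k + α + 1) / (k + 1) := by field_simp; ring
      rw [this]
      apply div_nonneg <;> linarith
    have h4 : Real.Gamma ((k + 1 : ℕ) + α + 1) / (k + 1).factorial =
        (1 + α / ((k : ℝ) + 1)) * (Real.Gamma (k + α + 1) / k.factorial) := by
      rw [lag_gamma_succ α hα, Nat.factorial_succ]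
      push_cast
      field_simp
      ring
    rw [h4, Real.sqrt_mul h5]
    have : 0 < Real.sqrt (Real.Gamma (k + α + 1) / k.factorial) := by positivity
    field_simp

open Finset in
lemma lag_growth (α : ℝ) (hα : -1 < α) (y : ℝ) (hy : 0 ≤ y) (ε : ℝ) (hε : 0 < ε) :
    ∃ C, 0 ≤ C ∧ ∀ m : ℕ, |lagPhi α m y| ≤
      C * ((1 + ε) ^ m * Real.sqrt (Real.Gamma (m + α + 1) / m.factorial)) := by
  obtain ⟨C, hC0, hC⟩ := lag_gamma_bound α hα ((y + 1) / ε) (by positivity)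
  refine ⟨C, hC0, fun m => ?_⟩
  have hg := lag_gamma_pos α hα m
  have hf : (0 : ℝ) < m.factorial := by positivity
  have key : |genLaguerre α m y| ≤ Real.Gamma (m + α + 1) / m.factorial * (C * (1 + ε) ^ m) := by
    unfold genLaguerre
    refine (abs_sum_le_sum_abs _ _).trans ?_
    rw [add_comm 1 ε, add_pow, mul_sum, mul_sum]
    refine sum_le_sum fun k hk => ?_
    have hk' : k ≤ m := by simpa [Nat.lt_succ_iff] using hk
    have hgk := lag_gamma_pos α hα k
    have h3 : (0 : ℝ) < k.factorial := by positivity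
    have h4 : (0 : ℝ) < (m - k).factorial := by positivity
    have h5 : y ^ k / Real.Gamma (k + α + 1) ≤ C * ε ^ k := by
      have h6 : y ^ k ≤ (y + 1) ^ k := pow_le_pow_left₀ hy (by linarith) k
      calc y ^ k / Real.Gamma (k + α + 1) ≤ (y + 1) ^ k / Real.Gamma (k + α + 1) := by gcongr
        _ = ((y + 1) / ε) ^ k / Real.Gamma (k + α + 1) * ε ^ k := by
          rw [div_pow]; field_simp
        _ ≤ C * ε ^ k := by gcongr; exact hC k
    have h7 : |(-1 : ℝ) ^ k / k.factorial * (Real.Gamma (m + α + 1) /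
        (Real.Gamma (k + α + 1) * (m - k).factorial)) * y ^ k| =
        Real.Gamma (m + α + 1) / m.factorial * (m.choose k) *
          (y ^ k / Real.Gamma (k + α + 1)) := by
      rw [abs_mul, abs_mul, abs_div, abs_pow, abs_neg, abs_one, one_pow, abs_of_pos h3,
        abs_of_pos (div_pos hg (mul_pos hgk h4)), abs_of_nonneg (pow_nonneg hy k),
        Nat.cast_choose ℝ hk']
      field_simp
    rw [h7]
    calc _ ≤ Real.Gamma (m + α + 1) / m.factorial * (m.choose k) * (C * ε ^ k) := by gcongr
      _ = _ := by rw [one_pow]; ring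
  unfold lagPhi
  rw [abs_mul, abs_of_nonneg (Real.sqrt_nonneg _)]
  refine (mul_le_mul_of_nonneg_left key (Real.sqrt_nonneg _)).trans (le_of_eq ?_)
  set g := Real.Gamma (m + α + 1) / m.factorial with hgdef
  have hgpos : 0 < g := by positivity
  have : (m.factorial : ℝ) / Real.Gamma (m + α + 1) = g⁻¹ := by rw [hgdef, inv_div]
  rw [this, Real.sqrt_inv]
  have h8 := Real.mul_self_sqrt hgpos.le
  have h9 : 0 < Real.sqrt g := Real.sqrt_pos.2 hgpos
  field_simp
  nlinarith

lemma lag_phi_summable (α : ℝ) (hα : -1 < α) (y : ℝ) (hy : 0 ≤ y) (r : ℝ) (hr0 : 0 ≤ r)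
    (hr : r < 1) : Summable (fun m : ℕ => |lagPhi α m y| * r ^ m) := by
  obtain ⟨s, hs, hs1⟩ := exists_between hr
  have hs0 : 0 < s := lt_of_le_of_lt hr0 hs
  obtain ⟨C, hC0, hC⟩ := lag_growth α hα y hy (1 - s) (by linarith)
  have hsum := (lag_norm_summable α hα (s * (1 + (1 - s))) (by nlinarith) (by nlinarith)).mul_left C
  refine Summable.of_nonneg_of_le (fun m => by positivity) (fun m => ?_) hsum
  have h1 : r ^ m ≤ s ^ m := pow_le_pow_left₀ hr0 hs.le m
  calc |lagPhi α m y| * r ^ m ≤ (C * ((1 + (1 - s)) ^ m *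
        Real.sqrt (Real.Gamma (m + α + 1) / m.factorial))) * s ^ m := by
        apply mul_le_mul (hC m) h1 (by positivity)
        have : (0 : ℝ) ≤ 1 + (1 - s) := by linarith
        positivity
    _ = _ := by rw [mul_pow]; ring

lemma lag_abs_int (α : ℝ) (hα : -1 < α) (m n : ℕ) :
    ∫ x in Set.Ioi (0 : ℝ), |lagPhi α m x * lagPhi α n x * (x ^ α * Real.exp (-x))| ≤ 1 := by
  have hb : ∫ x in Set.Ioi (0 : ℝ),
      ((1 / 2) * (lagPhi α m x * lagPhi α m x * (x ^ α * Real.exp (-x))) +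
        (1 / 2) * (lagPhi α n x * lagPhi α n x * (x ^ α * Real.exp (-x)))) = 1 := by
    rw [integral_add ((lag_phi_int α hα m m).const_mul _) ((lag_phi_int α hα n n).const_mul _),
      integral_const_mul, integral_const_mul, lag_ortho α hα, lag_ortho α hα]
    norm_num
  rw [← hb]
  refine setIntegral_mono_on (lag_phi_int α hα m n).abs
    (((lag_phi_int α hα m m).const_mul _).add ((lag_phi_int α hα n n).const_mul _))
    measurableSet_Ioi fun x hx => ?_
  have hx' : (0 : ℝ) < x := hx
  have hw : 0 ≤ x ^ α * Real.exp (-x) := by positivity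
  rw [abs_mul, abs_of_nonneg hw, ← mul_add, ← add_mul, ← mul_assoc (1 / 2 : ℝ)]
  refine mul_le_mul_of_nonneg_right ?_ hw
  rw [abs_le]
  constructor <;>
  nlinarith [sq_nonneg (lagPhi α m x - lagPhi α n x), sq_nonneg (lagPhi α m x + lagPhi α n x)]

/-- Eigenrelation for the dual transform: `S_y^α φ_n^α = φ_n^α(y) · qⁿ`. -/
theorem stmt_10 (α : ℝ) (hα : -1 < α) (y : ℝ) (hy : 0 ≤ y) (n : ℕ)
    (q : ℍ[ℝ]) (hq : ‖q‖ < 1) :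
    (∫ x in Set.Ioi (0 : ℝ),
      (x ^ α * Real.exp (-x)) • (Rker α q x y * (lagPhi α n x : ℍ[ℝ]))) =
    lagPhi α n y • q ^ n := by
  have hE : ∀ x : ℝ, (x ^ α * Real.exp (-x)) • (Rker α q x y * (lagPhi α n x : ℍ[ℝ])) =
      ∑' m : ℕ, (lagPhi α m x * lagPhi α n x * (x ^ α * Real.exp (-x))) •
        (lagPhi α m y • q ^ m) := by
    intro x
    unfold Rker
    rw [← tsum_mul_right, ← tsum_const_smul'']
    refine tsum_congr fun m => ?_
    rw [← Quaternion.coe_commutes, Quaternion.coe_mul_eq_smul, smul_smul, smul_smul, smul_smul]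
    congr 1
    ring
  simp_rw [hE]
  have hI : ∀ m : ℕ, Integrable (fun x : ℝ =>
      (lagPhi α m x * lagPhi α n x * (x ^ α * Real.exp (-x))) • (lagPhi α m y • q ^ m))
      (volume.restrict (Set.Ioi 0)) := fun m => (lag_phi_int α hα m n).smul_const _
  have hS : Summable fun m : ℕ => ∫ x in Set.Ioi (0 : ℝ),
      ‖(lagPhi α m x * lagPhi α n x * (x ^ α * Real.exp (-x))) • (lagPhi α m y • q ^ m)‖ := by
    refine Summable.of_nonneg_of_le (fun m => integral_nonneg fun x => norm_nonneg _)
      (fun m => ?_) (lag_phi_summable α hα y hy ‖q‖ (norm_nonneg _) hq)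
    simp only [norm_smul, norm_pow, Real.norm_eq_abs]
    rw [integral_mul_const]
    exact mul_le_of_le_one_left (by positivity) (lag_abs_int α hα m n)
  have h := hasSum_integral_of_summable_integral_norm hI hS
  rw [← h.tsum_eq]
  rw [tsum_eq_single n]
  · rw [integral_smul_const, lag_ortho α hα]
    simp
  · intro m hm
    rw [integral_smul_const, lag_ortho α hα, if_neg hm.symm, zero_smul]
end

section
/- Range of S_y^α lies in the weighted Bergman sequence space (Proposition range): let α > -1, β, η > 0, y > 0, and let φ : (0,∞) → ℍ be measurable with ∫_0^∞ ‖φ(x)‖² x^α e^{-x} dx < ∞. Then there exists a sequence c : ℕ → ℍ such that S_y^α φ(q) = Σ_{n=0}^∞ qⁿ c_n for every quaternion q with ‖q‖ < 1, and Σ_{n=0}^∞ γ_n^{β,η} ‖c_n‖² < ∞. -/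
open MeasureTheory Real Quaternion

/-- `γ_n^{β,η} = Γ(η)Γ(β+n)/Γ(β+η+n)`. -/
noncomputable def gamCoef (β η : ℝ) (n : ℕ) : ℝ :=
  Real.Gamma η * Real.Gamma (β + n) / Real.Gamma (β + η + n)

/-- The dual transform `S_y^α φ(q) = ∫_0^∞ R_q^α(x,y) φ(x) x^α e^{-x} dx`. -/
noncomputable def Sdual (α y : ℝ) (φ : ℝ → ℍ[ℝ]) (q : ℍ[ℝ]) : ℍ[ℝ] :=
  ∫ x in Set.Ioi (0 : ℝ), (x ^ α * Real.exp (-x)) • (Rker α q x y * φ x)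


noncomputable def rr (α : ℝ) (n : ℕ) : ℝ := Real.Gamma (n + α + 1) / (Nat.factorial n : ℝ)

lemma gam_pos {α : ℝ} (hα : -1 < α) (n : ℕ) : 0 < Real.Gamma (n + α + 1) := by
  apply Real.Gamma_pos_of_pos
  have : (0 : ℝ) ≤ n := n.cast_nonneg
  linarith

lemma rr_pos {α : ℝ} (hα : -1 < α) (n : ℕ) : 0 < rr α n :=
  div_pos (gam_pos hα n) (by positivity)

lemma gam_succ {α : ℝ} (hα : -1 < α) (n : ℕ) :
    Real.Gamma ((n + 1 : ℕ) + α + 1) = (n + α + 1) * Real.Gamma (n + α + 1) := by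
  have : (0 : ℝ) ≤ n := n.cast_nonneg
  rw [← Real.Gamma_add_one (by linarith)]
  congr 1
  push_cast
  ring

lemma rr_succ {α : ℝ} (hα : -1 < α) (n : ℕ) :
    rr α (n + 1) * (n + 1) = (n + 1 + α) * rr α n := by
  unfold rr
  rw [gam_succ hα, Nat.factorial_succ]
  have : (Nat.factorial n : ℝ) ≠ 0 := by positivity
  push_cast
  field_simp
  ring

lemma lag_eq {α : ℝ} (n : ℕ) (x : ℝ) :
    genLaguerre α n x = rr α n * ∑ k ∈ Finset.range (n + 1),
      (n.choose k : ℝ) * ((-x) ^ k / Real.Gamma (k + α + 1)) := by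
  unfold genLaguerre rr
  rw [Finset.mul_sum]
  refine Finset.sum_congr rfl fun k hk => ?_
  have hk' : k ≤ n := Nat.lt_succ_iff.1 (Finset.mem_range.1 hk)
  rw [Nat.cast_choose ℝ hk', neg_pow x k]
  have h1 : (Nat.factorial n : ℝ) ≠ 0 := by positivity
  have h2 : (Nat.factorial k : ℝ) ≠ 0 := by positivity
  have h3 : (Nat.factorial (n - k) : ℝ) ≠ 0 := by positivity
  by_cases h : Real.Gamma (k + α + 1) = 0
  · simp [h]
  field_simp

lemma sum_ext_choose (b : ℕ → ℝ) (n N : ℕ) (h : n + 1 ≤ N) :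
    ∑ k ∈ Finset.range (n + 1), (n.choose k : ℝ) * b k
      = ∑ k ∈ Finset.range N, (n.choose k : ℝ) * b k := by
  apply Finset.sum_subset (Finset.range_mono h)
  intro k _ hk
  rw [Finset.mem_range, not_lt] at hk
  rw [Nat.choose_eq_zero_of_lt (by omega)]
  simp

lemma choose_id (α : ℝ) (n k : ℕ) (hk : k ≤ n + 1) :
    (n + 2 + α) * ((n + 2).choose (k + 1) : ℝ) - (2 * n + α + 3) * ((n + 1).choose (k + 1) : ℝ)
      + (n + 1) * (n.choose (k + 1) : ℝ) = (k + 1 + α) * ((n + 1).choose k : ℝ) := by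
  have h1 : ((n + 2).choose (k + 1) : ℝ) = (n + 1).choose k + (n + 1).choose (k + 1) := by
    exact_mod_cast Nat.choose_succ_succ (n + 1) k
  have h2 : ((n + 1).choose (k + 1) : ℝ) = n.choose k + n.choose (k + 1) := by
    exact_mod_cast Nat.choose_succ_succ n k
  have h3 : ((n : ℝ) + 1) * n.choose k = (n + 1).choose (k + 1) * (k + 1) := by
    exact_mod_cast Nat.add_one_mul_choose_eq n k
  have h4 : ((n + 1).choose (k + 1) : ℝ) * (k + 1) = (n + 1).choose k * ((n : ℝ) + 1 - k) := by
    have := Nat.choose_succ_right_eq (n + 1) k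
    have h := congrArg (Nat.cast : ℕ → ℝ) this
    push_cast [Nat.cast_sub hk] at h
    linarith
  rw [h1]
  linear_combination (n + 1 : ℝ) * (-h2) - h3 - h4

lemma P_rec {α : ℝ} (x : ℝ) (b : ℕ → ℝ) (hb : ∀ k : ℕ, (k + 1 + α) * b (k + 1) = -x * b k)
    (P : ℕ → ℝ) (hP : ∀ n, P n = ∑ k ∈ Finset.range (n + 1), (n.choose k : ℝ) * b k) (n : ℕ) :
    (n + 2 + α) * P (n + 2) = (2 * n + α + 3 - x) * P (n + 1) - (n + 1) * P n := by
  have e1 : -x * P (n + 1)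
      = ∑ k ∈ Finset.range (n + 2), (k + 1 + α) * ((n + 1).choose k : ℝ) * b (k + 1) := by
    rw [hP, Finset.mul_sum]
    refine Finset.sum_congr rfl fun k _ => ?_
    linear_combination (-((n + 1).choose k : ℝ)) * hb k
  have e2 : (n + 2 + α) * P (n + 2) - (2 * n + α + 3) * P (n + 1) + (n + 1) * P n
      = -x * P (n + 1) := by
    rw [e1, hP (n + 2), hP (n + 1), hP n, sum_ext_choose b (n + 1) (n + 3) (by omega),
      sum_ext_choose b n (n + 3) (by omega), Finset.mul_sum, Finset.mul_sum, Finset.mul_sum,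
      ← Finset.sum_sub_distrib, ← Finset.sum_add_distrib, Finset.sum_range_succ']
    simp only [Nat.choose_zero_right]
    have : ∀ S T : ℝ, S = T → S + ((n + 2 + α) * (((1 : ℕ) : ℝ) * b 0) -
      (2 * n + α + 3) * (((1 : ℕ) : ℝ) * b 0) + (n + 1) * (((1 : ℕ) : ℝ) * b 0)) = T := by
      intro S T h; rw [h]; push_cast; ring
    apply this
    refine Finset.sum_congr rfl fun k hk => ?_
    have := choose_id α n k (by have := Finset.mem_range.1 hk; omega)
    linear_combination b (k + 1) * this
  linarith

lemma lag_rec {α : ℝ} (hα : -1 < α) (x : ℝ) (n : ℕ) :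
    (n + 2) * genLaguerre α (n + 2) x
      = (2 * n + α + 3 - x) * genLaguerre α (n + 1) x - (n + 1 + α) * genLaguerre α n x := by
  have h := P_rec (α := α) x (fun k : ℕ => (-x) ^ k / Real.Gamma (k + α + 1)) (by
    intro k
    have hg := gam_pos hα k
    have : (0 : ℝ) ≤ k := k.cast_nonneg
    have h2 : (k : ℝ) + α + 1 ≠ 0 := by linarith
    rw [gam_succ hα]
    field_simp
    ring) _ (fun n => rfl) n
  rw [lag_eq, lag_eq, lag_eq]
  have r1 := rr_succ hα n
  have r2 := rr_succ hα (n + 1)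
  push_cast at r2
  generalize ∑ k ∈ Finset.range (n + 2 + 1), ((n + 2).choose k : ℝ) * ((-x) ^ k / Real.Gamma (k + α + 1)) = P2 at *
  generalize ∑ k ∈ Finset.range (n + 1 + 1), ((n + 1).choose k : ℝ) * ((-x) ^ k / Real.Gamma (k + α + 1)) = P1 at *
  generalize ∑ k ∈ Finset.range (n + 1), (n.choose k : ℝ) * ((-x) ^ k / Real.Gamma (k + α + 1)) = P0 at *
  linear_combination P2 * r2 + rr α (n + 1) * h - P0 * r1

lemma quad_nonneg {x A s : ℝ} (hx : 0 < x) (hA : s ^ 2 / (2 * x) ≤ A) (d M : ℝ) :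
    0 ≤ A * d ^ 2 + x / 2 * M ^ 2 - s * M * d := by
  have h1 : x / 2 * (M - s * d / x) ^ 2 = x / 2 * M ^ 2 - s * M * d + s ^ 2 / (2 * x) * d ^ 2 := by
    field_simp
    ring
  have h2 : 0 ≤ x / 2 * (M - s * d / x) ^ 2 := by positivity
  have h3 := mul_le_mul_of_nonneg_right hA (sq_nonneg d)
  linarith

lemma energy_bound {α x : ℝ} (hx : 0 < x) (L r : ℕ → ℝ) (hr : ∀ n, 0 < r n)
    (hrs : ∀ n : ℕ, r (n + 1) * (n + 1) = (n + 1 + α) * r n)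
    (hL : ∀ n : ℕ, (n + 2) * L (n + 2) = (2 * n + α + 3 - x) * L (n + 1) - (n + 1 + α) * L n) :
    ∃ C, 0 ≤ C ∧ ∀ n, L n ^ 2 / r n ≤ C := by
  obtain ⟨c, hc⟩ : ∃ c, c = α - 1 / 2 := ⟨_, rfl⟩
  obtain ⟨F, hF⟩ : ∃ F : ℕ → ℝ, ∀ n, F n = (n + 1 + c) * (L (n + 1) - L n) ^ 2
      + x * L (n + 1) ^ 2 - (x + c) * L (n + 1) * (L (n + 1) - L n) := ⟨_, fun _ => rfl⟩
  obtain ⟨N, hN⟩ := exists_nat_ge (max ((x + c) ^ 2 / (2 * x) - 1 - c)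
    (2 * ((x + c) ^ 2 / (2 * x) - α * (c - 1) + (α - 1) ^ 2)))
  have hN1 := (le_max_left _ _).trans hN
  have hN2 := (le_max_right _ _).trans hN
  have hlow : ∀ n, N ≤ n → x / 2 * L (n + 1) ^ 2 ≤ F n := by
    intro n hn
    have hn' : (N : ℝ) ≤ n := by exact_mod_cast hn
    have := quad_nonneg (A := n + 1 + c) (s := x + c) hx (by linarith)
      (L (n + 1) - L n) (L (n + 1))
    rw [hF]
    linarith
  have hstep : ∀ n, N ≤ n → (n + 2) * F (n + 1) ≤ (n + 2 + α) * F n := by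
    intro n hn
    have hn' : (N : ℝ) ≤ n := by exact_mod_cast hn
    have hq := quad_nonneg (A := (n + 2) / 2 + α * (c - 1) - (α - 1) ^ 2) (s := x + c) hx
      (by linarith) (L (n + 1) - L n) (L (n + 1))
    have hn2 : (0 : ℝ) < n + 2 := by positivity
    have hd : L (n + 2) = L (n + 1) + (L (n + 1) - L n) +
        ((α - 1) * (L (n + 1) - L n) - x * L (n + 1)) / (n + 2) := by
      have := hL n
      field_simp
      linarith
    have key : (n + 2 + α) * F n - (n + 2) * F (n + 1) =
      ((n + 2) / 2 + α * (c - 1) - (α - 1) ^ 2) * (L (n + 1) - L n) ^ 2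
        + x / 2 * L (n + 1) ^ 2 - (x + c) * L (n + 1) * (L (n + 1) - L n) := by
      rw [hF, hF]
      simp only [show n + 1 + 1 = n + 2 from rfl]
      rw [hd, hc]
      push_cast
      generalize L (n + 1) = M
      generalize L n = Z
      field_simp
      ring
    linarith
  have hmono : ∀ m, F (N + m) / r (N + m + 1) ≤ F N / r (N + 1) := by
    intro m
    induction m with
    | zero => simp
    | succ m ih =>
      refine le_trans ?_ ih
      have h1 := hstep (N + m) (by omega)
      have h2 := hrs (N + m + 1)
      have p1 := hr (N + m + 1)
      have p2 := hr (N + m + 2)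
      simp only [show N + (m + 1) = N + m + 1 by ring]
      rw [div_le_div_iff₀ p2 p1]
      have q : (0 : ℝ) < (N + m : ℕ) + 2 := by positivity
      have h3 := mul_le_mul_of_nonneg_right h1 p1.le
      have h4 : r (N + m + 2) * (((N + m : ℕ) : ℝ) + 2) = ((N + m : ℕ) + 2 + α) * r (N + m + 1) := by
        push_cast at h2 ⊢
        linear_combination h2
      have h5 : (((N + m : ℕ) : ℝ) + 2) * (F (N + m + 1) * r (N + m + 1))
          ≤ (((N + m : ℕ) : ℝ) + 2) * (F (N + m) * r (N + m + 2)) := by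
        linear_combination h3 - F (N + m) * h4
      exact le_of_mul_le_mul_left h5 q
  refine ⟨∑ i ∈ Finset.range (N + 1), L i ^ 2 / r i + 2 / x * |F N / r (N + 1)|, ?_, ?_⟩
  · have : 0 ≤ ∑ i ∈ Finset.range (N + 1), L i ^ 2 / r i :=
      Finset.sum_nonneg fun i _ => div_nonneg (sq_nonneg _) (hr i).le
    positivity
  intro n
  have hs : ∀ i ∈ Finset.range (N + 1), 0 ≤ L i ^ 2 / r i :=
    fun i _ => div_nonneg (sq_nonneg _) (hr i).le
  by_cases hn : n < N + 1
  · have := Finset.single_le_sum hs (Finset.mem_range.2 hn)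
    have : 0 ≤ 2 / x * |F N / r (N + 1)| := by positivity
    linarith
  · obtain ⟨m, rfl⟩ : ∃ m, n = N + m + 1 := ⟨n - (N + 1), by omega⟩
    have h1 := hlow (N + m) (by omega)
    have h2 := (hmono m).trans (le_abs_self _)
    have h3 : L (N + m + 1) ^ 2 ≤ 2 / x * F (N + m) := by
      rw [div_mul_eq_mul_div, le_div_iff₀ hx]
      linarith
    have h4 : L (N + m + 1) ^ 2 / r (N + m + 1) ≤ 2 / x * (F (N + m) / r (N + m + 1)) := by
      rw [← mul_div_assoc]
      exact div_le_div_of_nonneg_right h3 (hr _).le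
    have h5 : 2 / x * (F (N + m) / r (N + m + 1)) ≤ 2 / x * |F N / r (N + 1)| :=
      mul_le_mul_of_nonneg_left h2 (by positivity)
    have h6 := Finset.sum_nonneg hs
    linarith

lemma lagPhi_sq {α : ℝ} (hα : -1 < α) (n : ℕ) (x : ℝ) :
    lagPhi α n x ^ 2 = genLaguerre α n x ^ 2 / rr α n := by
  have := gam_pos hα n
  unfold lagPhi rr
  rw [mul_pow, Real.sq_sqrt (by positivity)]
  field_simp

lemma lagPhi_bdd {α y : ℝ} (hα : -1 < α) (hy : 0 < y) :
    ∃ C, 0 ≤ C ∧ ∀ n, lagPhi α n y ^ 2 ≤ C := by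
  simp only [lagPhi_sq hα]
  exact energy_bound hy _ _ (rr_pos hα) (rr_succ hα) (lag_rec hα y)

lemma gamCoef_nonneg {β η : ℝ} (hβ : 0 < β) (hη : 0 < η) (n : ℕ) : 0 ≤ gamCoef β η n := by
  unfold gamCoef
  have h1 := Real.Gamma_pos_of_pos hη
  have h2 : 0 < Real.Gamma (β + n) := Real.Gamma_pos_of_pos (by positivity)
  have h3 : 0 < Real.Gamma (β + η + n) := Real.Gamma_pos_of_pos (by positivity)
  positivity

lemma gamCoef_le {β η : ℝ} (hβ : 0 < β) (hη : 0 < η) (n : ℕ) :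
    gamCoef β η n ≤ gamCoef β η 0 := by
  induction n with
  | zero => exact le_rfl
  | succ n ih =>
    refine le_trans ?_ ih
    have hn := gamCoef_nonneg hβ hη n
    have h : gamCoef β η (n + 1) = gamCoef β η n * ((β + n) / (β + η + n)) := by
      unfold gamCoef
      have p1 : (0 : ℝ) < β + n := by positivity
      have p2 : (0 : ℝ) < β + η + n := by positivity
      have h3 : 0 < Real.Gamma (β + η + n) := Real.Gamma_pos_of_pos (by positivity)
      push_cast
      rw [← add_assoc, ← add_assoc, Real.Gamma_add_one p1.ne', Real.Gamma_add_one p2.ne']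
      field_simp
    rw [h]
    apply mul_le_of_le_one_right hn
    rw [div_le_one (by positivity)]
    linarith

noncomputable def lagMeas (α : ℝ) : Measure ℝ :=
  (volume.restrict (Set.Ioi (0 : ℝ))).withDensity
    (fun x => ENNReal.ofReal (x ^ α * Real.exp (-x)))

lemma w_meas (α : ℝ) : Measurable (fun x : ℝ => ENNReal.ofReal (x ^ α * Real.exp (-x))) := by
  fun_prop

lemma w_toReal (α : ℝ) : ∀ᵐ x ∂(volume.restrict (Set.Ioi (0 : ℝ))),
    (ENNReal.ofReal (x ^ α * Real.exp (-x))).toReal = x ^ α * Real.exp (-x) := by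
  filter_upwards [ae_restrict_mem measurableSet_Ioi] with x hx
  have hx' : (0 : ℝ) < x := hx
  exact ENNReal.toReal_ofReal (by positivity)

lemma integral_lagMeas {E : Type*} [NormedAddCommGroup E] [NormedSpace ℝ E] (α : ℝ) (g : ℝ → E) :
    ∫ x, g x ∂(lagMeas α) = ∫ x in Set.Ioi (0 : ℝ), (x ^ α * Real.exp (-x)) • g x := by
  unfold lagMeas
  rw [integral_withDensity_eq_integral_toReal_smul (w_meas α) (by simp)]
  apply integral_congr_ae
  filter_upwards [w_toReal α] with x hx
  rw [hx]

lemma integrable_lagMeas {E : Type*} [NormedAddCommGroup E] [NormedSpace ℝ E] (α : ℝ)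
    (g : ℝ → E) : Integrable g (lagMeas α) ↔
      IntegrableOn (fun x => (x ^ α * Real.exp (-x)) • g x) (Set.Ioi (0 : ℝ)) := by
  unfold lagMeas
  rw [integrable_withDensity_iff_integrable_smul' (w_meas α) (by simp)]
  apply integrable_congr
  filter_upwards [w_toReal α] with x hx
  rw [hx]

lemma w_pow (α : ℝ) (k : ℕ) {x : ℝ} (hx : 0 < x) :
    Real.exp (-x) * x ^ ((k + α + 1) - 1) = (x ^ α * Real.exp (-x)) • x ^ k := by
  rw [show (k + α + 1) - 1 = α + k by ring, Real.rpow_add hx, Real.rpow_natCast, smul_eq_mul]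
  ring

lemma pow_integrable {α : ℝ} (hα : -1 < α) (k : ℕ) :
    Integrable (fun x : ℝ => x ^ k) (lagMeas α) := by
  rw [integrable_lagMeas]
  have hk : (0 : ℝ) ≤ k := k.cast_nonneg
  refine (Real.GammaIntegral_convergent (s := k + α + 1) (by linarith)).congr_fun ?_
    measurableSet_Ioi
  intro x hx
  exact w_pow α k hx

lemma pow_integral {α : ℝ} (hα : -1 < α) (k : ℕ) :
    ∫ x : ℝ, x ^ k ∂(lagMeas α) = Real.Gamma (k + α + 1) := by
  have hk : (0 : ℝ) ≤ k := k.cast_nonneg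
  rw [integral_lagMeas, Real.Gamma_eq_integral (by linarith)]
  refine setIntegral_congr_fun measurableSet_Ioi ?_
  intro x hx
  exact (w_pow α k hx).symm

lemma gam_poch {α : ℝ} (hα : -1 < α) (k m : ℕ) :
    Real.Gamma ((k + m : ℕ) + α + 1)
      = (ascPochhammer ℝ m).eval (α + 1 + k) * Real.Gamma (k + α + 1) := by
  induction m with
  | zero => simp
  | succ m ih =>
    rw [← add_assoc, gam_succ hα, ih, ascPochhammer_succ_eval]
    push_cast
    ring

lemma lag_poly (α : ℝ) (n : ℕ) (x : ℝ) :
    genLaguerre α n x = ∑ k ∈ Finset.range (n + 1),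
      (rr α n * ((n.choose k : ℝ) * ((-1) ^ k / Real.Gamma (k + α + 1)))) * x ^ k := by
  rw [lag_eq, Finset.mul_sum]
  refine Finset.sum_congr rfl fun k _ => ?_
  rw [neg_pow x k]
  ring

lemma lag_mul_pow_integrable {α : ℝ} (hα : -1 < α) (n m : ℕ) :
    Integrable (fun x : ℝ => genLaguerre α n x * x ^ m) (lagMeas α) := by
  simp only [lag_poly, Finset.sum_mul]
  apply integrable_finsetSum
  intro k _
  simp only [mul_assoc, ← pow_add]
  iterate 3 apply Integrable.const_mul
  exact pow_integrable hα _

lemma lag_mul_lag_integrable {α : ℝ} (hα : -1 < α) (n m : ℕ) :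
    Integrable (fun x : ℝ => genLaguerre α n x * genLaguerre α m x) (lagMeas α) := by
  simp only [lag_poly α m, Finset.mul_sum]
  apply integrable_finsetSum
  intro k _
  simp only [mul_left_comm (genLaguerre α n _)]
  apply Integrable.const_mul
  exact lag_mul_pow_integrable hα n k

lemma lag_mul_pow_integral {α : ℝ} (hα : -1 < α) (n m : ℕ) :
    ∫ x : ℝ, genLaguerre α n x * x ^ m ∂(lagMeas α) =
      rr α n * ((-1) ^ n * (fwdDiff 1)^[n] (ascPochhammer ℝ m).eval (α + 1)) := by
  simp only [lag_poly, Finset.sum_mul]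
  rw [integral_finsetSum]
  · rw [fwdDiff_iter_eq_sum_shift, Finset.mul_sum, Finset.mul_sum]
    refine Finset.sum_congr rfl fun k hk => ?_
    have hk' : k ≤ n := Nat.lt_succ_iff.1 (Finset.mem_range.1 hk)
    simp only [mul_assoc, ← pow_add]
    have hg := gam_pos hα k
    rw [integral_const_mul, integral_const_mul, integral_const_mul, pow_integral hα, gam_poch hα]
    obtain ⟨j, rfl⟩ := Nat.exists_eq_add_of_le hk'
    have : (-1 : ℝ) ^ (k + j) * (-1) ^ j = (-1) ^ k := by
      rw [pow_add, mul_assoc, ← mul_pow]; simp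
    simp only [nsmul_eq_mul, mul_one, zsmul_eq_mul, Nat.add_sub_cancel_left]
    push_cast
    rw [← this]
    field_simp
  · intro k _
    simp only [mul_assoc, ← pow_add]
    iterate 3 apply Integrable.const_mul
    exact pow_integrable hα _

lemma lag_mul_pow_lt {α : ℝ} (hα : -1 < α) {n m : ℕ} (h : m < n) :
    ∫ x : ℝ, genLaguerre α n x * x ^ m ∂(lagMeas α) = 0 := by
  rw [lag_mul_pow_integral hα, Polynomial.fwdDiff_iter_eq_zero_of_degree_lt
    (by rwa [ascPochhammer_natDegree])]
  simp

lemma lag_mul_pow_self {α : ℝ} (hα : -1 < α) (n : ℕ) :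
    ∫ x : ℝ, genLaguerre α n x * x ^ n ∂(lagMeas α) = rr α n * ((-1) ^ n * Nat.factorial n) := by
  have h := Polynomial.fwdDiff_iter_degree_eq_factorial (ascPochhammer ℝ n)
  rw [ascPochhammer_natDegree, (monic_ascPochhammer ℝ n).leadingCoeff] at h
  rw [lag_mul_pow_integral hα, h]
  simp

lemma lag_inner_sum {α : ℝ} (hα : -1 < α) (n m : ℕ) :
    ∫ x : ℝ, genLaguerre α n x * genLaguerre α m x ∂(lagMeas α) =
      ∑ k ∈ Finset.range (m + 1),
      (rr α m * ((m.choose k : ℝ) * ((-1) ^ k / Real.Gamma (k + α + 1)))) *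
        ∫ x : ℝ, genLaguerre α n x * x ^ k ∂(lagMeas α) := by
  simp only [lag_poly α m, Finset.mul_sum]
  simp only [mul_left_comm (genLaguerre α n _)]
  rw [integral_finsetSum]
  · simp only [integral_const_mul]
  · intro k _
    apply Integrable.const_mul
    exact lag_mul_pow_integrable hα n k

lemma lag_orth_lt {α : ℝ} (hα : -1 < α) {n m : ℕ} (h : m < n) :
    ∫ x : ℝ, genLaguerre α n x * genLaguerre α m x ∂(lagMeas α) = 0 := by
  rw [lag_inner_sum hα]
  apply Finset.sum_eq_zero
  intro k hk
  rw [lag_mul_pow_lt hα (by have := Finset.mem_range.1 hk; omega), mul_zero]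

lemma lag_orth_self {α : ℝ} (hα : -1 < α) (n : ℕ) :
    ∫ x : ℝ, genLaguerre α n x * genLaguerre α n x ∂(lagMeas α) = rr α n := by
  rw [lag_inner_sum hα, Finset.sum_range_succ, Finset.sum_eq_zero, lag_mul_pow_self hα]
  · have hg := gam_pos hα n
    have h1 : (Nat.factorial n : ℝ) ≠ 0 := by positivity
    have h2 : (-1 : ℝ) ^ n * (-1) ^ n = 1 := by rw [← mul_pow]; simp
    rw [Nat.choose_self]
    unfold rr
    push_cast
    field_simp
    linear_combination Real.Gamma (n + α + 1) * h2
  · intro k hk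
    rw [lag_mul_pow_lt hα (Finset.mem_range.1 hk), mul_zero]

lemma phi_orth {α : ℝ} (hα : -1 < α) (n m : ℕ) :
    ∫ x : ℝ, lagPhi α n x * lagPhi α m x ∂(lagMeas α) = if n = m then 1 else 0 := by
  have e : ∀ x, lagPhi α n x * lagPhi α m x =
    (Real.sqrt ((Nat.factorial n : ℝ) / Real.Gamma (n + α + 1)) *
      Real.sqrt ((Nat.factorial m : ℝ) / Real.Gamma (m + α + 1))) *
      (genLaguerre α n x * genLaguerre α m x) := by
    intro x; unfold lagPhi; ring
  simp only [e, integral_const_mul]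
  rcases lt_trichotomy n m with h | h | h
  · simp only [mul_comm (genLaguerre α n _)]
    rw [lag_orth_lt hα h, if_neg h.ne, mul_zero]
  · subst h
    have hg := gam_pos hα n
    rw [lag_orth_self hα, if_pos rfl, Real.mul_self_sqrt (by positivity)]
    unfold rr
    field_simp
  · rw [lag_orth_lt hα h, if_neg h.ne', mul_zero]

lemma phi_cont (α : ℝ) (n : ℕ) : Continuous (lagPhi α n) := by
  unfold lagPhi genLaguerre
  fun_prop

lemma phi_memLp {α : ℝ} (hα : -1 < α) (n : ℕ) : MemLp (lagPhi α n) 2 (lagMeas α) := by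
  rw [memLp_two_iff_integrable_sq (phi_cont α n).aestronglyMeasurable]
  have e : ∀ x, lagPhi α n x ^ 2 = (rr α n)⁻¹ * (genLaguerre α n x * genLaguerre α n x) := by
    intro x; rw [lagPhi_sq hα]; ring
  simp only [e]
  exact (lag_mul_lag_integrable hα n n).const_mul _

lemma bessel {α : ℝ} (hα : -1 < α) {f : ℝ → ℝ} (hf : MemLp f 2 (lagMeas α)) :
    Summable fun n => (∫ x, lagPhi α n x * f x ∂(lagMeas α)) ^ 2 := by
  have inn : ∀ {g h : ℝ → ℝ} (hg : MemLp g 2 (lagMeas α)) (hh : MemLp h 2 (lagMeas α)),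
      inner ℝ (hg.toLp g) (hh.toLp h) = ∫ x, g x * h x ∂(lagMeas α) := by
    intro g h hg hh
    rw [MeasureTheory.L2.inner_def]
    apply integral_congr_ae
    filter_upwards [hg.coeFn_toLp, hh.coeFn_toLp] with x h1 h2
    rw [h1, h2]
    simp [mul_comm]
  have ho : Orthonormal ℝ (fun n => (phi_memLp hα n).toLp (lagPhi α n)) := by
    rw [orthonormal_iff_ite]
    intro i j
    rw [inn, phi_orth hα]
  have := ho.inner_products_summable (x := hf.toLp f)
  simpa [inn] using this

lemma smul_int {α : ℝ} (hα : -1 < α) {φ : ℝ → ℍ[ℝ]} (hφ : MemLp φ 2 (lagMeas α)) (n : ℕ) :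
    Integrable (fun x => lagPhi α n x • φ x) (lagMeas α) := by
  have h : MemLp (lagPhi α n • φ) 1 (lagMeas α) := hφ.smul (phi_memLp hα n)
  exact memLp_one_iff_integrable.1 h

lemma bessel_quat {α : ℝ} (hα : -1 < α) {φ : ℝ → ℍ[ℝ]} (hφ : MemLp φ 2 (lagMeas α)) :
    Summable fun n => ‖∫ x, lagPhi α n x • φ x ∂(lagMeas α)‖ ^ 2 := by
  have b := stdOrthonormalBasis ℝ ℍ[ℝ]
  have hint : ∀ n, Integrable (fun x => lagPhi α n x • φ x) (lagMeas α) := smul_int hα hφ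
  have h : ∀ n, ‖∫ x, lagPhi α n x • φ x ∂(lagMeas α)‖ ^ 2
      = ∑ i, (∫ x, lagPhi α n x * inner ℝ (b i) (φ x) ∂(lagMeas α)) ^ 2 := by
    intro n
    rw [← b.sum_sq_inner_right]
    refine Finset.sum_congr rfl fun i _ => ?_
    rw [← integral_inner (hint n)]
    simp only [inner_smul_right]
  simp only [h]
  apply summable_sum
  intro i _
  exact bessel hα (hφ.const_inner (b i))

lemma norm_int_le {α : ℝ} (hα : -1 < α) {φ : ℝ → ℍ[ℝ]} (hφ : MemLp φ 2 (lagMeas α)) (n : ℕ) :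
    ∫ x, ‖lagPhi α n x • φ x‖ ∂(lagMeas α) ≤ 1 + ∫ x, ‖φ x‖ ^ 2 ∂(lagMeas α) := by
  have h1 : Integrable (fun x => lagPhi α n x * lagPhi α n x) (lagMeas α) :=
    (phi_memLp hα n).integrable_mul (phi_memLp hα n)
  have h2 : Integrable (fun x => ‖φ x‖ ^ 2) (lagMeas α) :=
    (memLp_two_iff_integrable_sq_norm hφ.1).1 hφ
  have e := phi_orth hα n n
  rw [if_pos rfl] at e
  rw [← e, ← integral_add h1 h2]
  apply integral_mono (smul_int hα hφ n).norm (h1.add h2)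
  intro x
  simp only [Pi.add_apply, norm_smul, Real.norm_eq_abs]
  nlinarith [sq_nonneg (|lagPhi α n x| - ‖φ x‖), abs_mul_abs_self (lagPhi α n x),
    sq_nonneg (‖φ x‖), abs_nonneg (lagPhi α n x), norm_nonneg (φ x)]

lemma phi_mem {α : ℝ} (φ : ℝ → ℍ[ℝ])
    (hmeas : AEStronglyMeasurable φ (volume.restrict (Set.Ioi 0)))
    (hL2 : (∫⁻ x in Set.Ioi (0 : ℝ),
      ENNReal.ofReal (‖φ x‖ ^ 2 * (x ^ α * Real.exp (-x)))) < ⊤) : MemLp φ 2 (lagMeas α) := by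
  have hm : AEStronglyMeasurable φ (lagMeas α) :=
    hmeas.mono_ac (withDensity_absolutelyContinuous _ _)
  rw [memLp_two_iff_integrable_sq_norm hm, integrable_lagMeas]
  have hm2 : AEStronglyMeasurable (fun x => (x ^ α * Real.exp (-x)) • ‖φ x‖ ^ 2)
      (volume.restrict (Set.Ioi 0)) := by
    apply AEStronglyMeasurable.fun_smul
    · exact Measurable.aestronglyMeasurable (by fun_prop)
    · exact hmeas.norm.pow 2
  refine ⟨hm2, ?_⟩
  rw [hasFiniteIntegral_iff_ofReal]
  · simpa [mul_comm] using hL2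
  · filter_upwards [ae_restrict_mem measurableSet_Ioi] with x hx
    have hx' : (0 : ℝ) < x := hx
    simp only [Pi.zero_apply, smul_eq_mul]
    positivity

/-- The range of `S_y^α` lies in the weighted Bergman sequence space (Proposition range):
`S_y^α φ` is a power series `Σ qⁿ c_n` with `Σ γ_n^{β,η} ‖c_n‖² < ∞`. -/
theorem stmt_12 (α β η y : ℝ) (hα : -1 < α) (hβ : 0 < β) (hη : 0 < η) (hy : 0 < y)
    (φ : ℝ → ℍ[ℝ])
    (hmeas : AEStronglyMeasurable φ (volume.restrict (Set.Ioi 0)))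
    (hL2 : (∫⁻ x in Set.Ioi (0 : ℝ),
      ENNReal.ofReal (‖φ x‖ ^ 2 * (x ^ α * Real.exp (-x)))) < ⊤) :
    ∃ c : ℕ → ℍ[ℝ],
      (∀ q : ℍ[ℝ], ‖q‖ < 1 → Sdual α y φ q = ∑' n : ℕ, q ^ n * c n) ∧
      Summable fun n : ℕ => gamCoef β η n * ‖c n‖ ^ 2 := by
  have hφ := phi_mem φ hmeas hL2
  obtain ⟨C, hC0, hC⟩ := lagPhi_bdd hα hy
  have hint : ∀ n, Integrable (fun x => lagPhi α n x • φ x) (lagMeas α) := smul_int hα hφ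
  refine ⟨fun n => lagPhi α n y • ∫ x, lagPhi α n x • φ x ∂(lagMeas α), ?_, ?_⟩
  · intro q hq
    unfold Sdual
    rw [← integral_lagMeas]
    have e1 : ∀ x, Rker α q x y * φ x
        = ∑' n : ℕ, (lagPhi α n y • q ^ n) * (lagPhi α n x • φ x) := by
      intro x
      unfold Rker
      rw [← tsum_mul_right]
      refine tsum_congr fun n => ?_
      rw [smul_mul_smul_comm, smul_mul_assoc, mul_comm (lagPhi α n x)]
    simp only [e1]
    have hF : ∀ n, Integrable (fun x => (lagPhi α n y • q ^ n) * (lagPhi α n x • φ x))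
      (lagMeas α) := fun n => (hint n).const_mul _
    have hS : Summable fun n => ∫ x, ‖(lagPhi α n y • q ^ n) * (lagPhi α n x • φ x)‖
        ∂(lagMeas α) := by
      refine Summable.of_nonneg_of_le (fun n => integral_nonneg fun x => norm_nonneg _) ?_
        ((summable_geometric_of_lt_one (norm_nonneg q) hq).mul_left
          (Real.sqrt C * (1 + ∫ x, ‖φ x‖ ^ 2 ∂(lagMeas α))))
      intro n
      have h0 := norm_int_le hα hφ n
      have h1 : |lagPhi α n y| ≤ Real.sqrt C := Real.abs_le_sqrt (hC n)
      have h2 : 0 ≤ ∫ x, ‖lagPhi α n x • φ x‖ ∂(lagMeas α) :=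
        integral_nonneg fun x => norm_nonneg _
      simp only [norm_mul]
      rw [integral_const_mul, norm_smul, norm_pow, Real.norm_eq_abs]
      calc |lagPhi α n y| * ‖q‖ ^ n * ∫ x, ‖lagPhi α n x • φ x‖ ∂(lagMeas α)
          ≤ Real.sqrt C * ‖q‖ ^ n * (1 + ∫ x, ‖φ x‖ ^ 2 ∂(lagMeas α)) := by gcongr
        _ = _ := by ring
    rw [← (hasSum_integral_of_summable_integral_norm hF hS).tsum_eq]
    refine tsum_congr fun n => ?_
    rw [integral_const_mul_of_integrable (hint n), smul_mul_assoc, mul_smul_comm]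
  · refine Summable.of_nonneg_of_le
      (fun n => mul_nonneg (gamCoef_nonneg hβ hη n) (sq_nonneg _)) ?_
      ((bessel_quat hα hφ).mul_left (gamCoef β η 0 * C))
    intro n
    rw [norm_smul, mul_pow, Real.norm_eq_abs, sq_abs, mul_assoc]
    have h0 := gamCoef_nonneg hβ hη 0
    have := hC n
    have := gamCoef_le hβ hη n
    gcongr
end
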